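/- For all λυ-terms t, t': if t →_B t' (a B-step in any context), then for every u with u ⋖ t there exists u' such that u →_B u' and u' ⋖ t'. -/

import Mathlib

namespace LambdaUpsilon

/-- Simple types. -/
inductive Ty : Type
  | base : Ty
  | arrow : Ty → Ty → Ty

mutual
/-- Terms of the λυ-calculus (de Bruijn).  `var k` represents the de Bruijn
index `k+1` (indices start at 1 in the paper). -/
inductive Tm : Type
  | var : ℕ → Tm
  | app : Tm → Tm → Tm
  | lam : Tm → Tm
  | sub : Tm → Sb → Tm

/-- Substitutions of the λυ-calculus: `slash t` is `t/`, `lift s` is `⇑(s)`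
and `shift` is `↑`. -/
inductive Sb : Type
  | slash : Tm → Sb
  | lift : Sb → Sb
  | shift : Sb
end

/-- The re-indexing function `⇑↑ᵢ`:  `⇑↑ᵢ(n) = n+1` if `n > i`, `n` otherwise,
homomorphic on applications, `⇑↑ᵢ(λt) = λ⇑↑_{i+1}(t)`, extended to simple
substitutions by `⇑↑ᵢ(t[u/]) = ⇑↑_{i+1}(t)[⇑↑ᵢ(u)/]`. -/
def liftshift (i : ℕ) : Tm → Tm
  | .var k => if i ≤ k then .var (k + 1) else .var k
  | .app t u => .app (liftshift i t) (liftshift i u)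
  | .lam t => .lam (liftshift (i + 1) t)
  | .sub t (.slash u) => .sub (liftshift (i + 1) t) (.slash (liftshift i u))
  | .sub t s => .sub t s

/-- The re-indexing function `↑ⁱ`, i.e. `⇑↑₀` applied `i` times. -/
def shiftN (i : ℕ) (t : Tm) : Tm := (liftshift 0)^[i] t

/-- The re-indexing function `⇑/ᵢ`:  `⇑/ᵢ(n) = n` if `n > i+1`, `1` if
`n = i+1`, `n+1` if `n ≤ i`, homomorphic on applications,
`⇑/ᵢ(λt) = λ⇑/_{i+1}(t)`, extended to simple substitutions by
`⇑/ᵢ(t[u/]) = ⇑/_{i+1}(t)[⇑/ᵢ(u)/]`. -/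
def liftcons (i : ℕ) : Tm → Tm
  | .var k => if i < k then .var k else if k = i then .var 0 else .var (k + 1)
  | .app t u => .app (liftcons i t) (liftcons i u)
  | .lam t => .lam (liftcons (i + 1) t)
  | .sub t (.slash u) => .sub (liftcons (i + 1) t) (.slash (liftcons i u))
  | .sub t s => .sub t s

/-- Substitution-free terms. -/
inductive Pure : Tm → Prop
  | var (k : ℕ) : Pure (.var k)
  | app {t u : Tm} : Pure t → Pure u → Pure (.app t u)
  | lam {t : Tm} : Pure t → Pure (.lam t)

/-- Terms containing no `⇑` and no `↑`: every substitution occurring in them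
is a simple substitution `[u/]`. -/
inductive Simple : Tm → Prop
  | var (k : ℕ) : Simple (.var k)
  | app {t u : Tm} : Simple t → Simple u → Simple (.app t u)
  | lam {t : Tm} : Simple t → Simple (.lam t)
  | sub {t u : Tm} : Simple t → Simple u → Simple (.sub t (.slash u))

mutual
/-- The simple typing system of λυ: `TypT Γ t A` is `Γ ⊢ t : A`. -/
inductive TypT : List Ty → Tm → Ty → Prop
  | var {Γ : List Ty} {k : ℕ} {A : Ty} : Γ[k]? = some A → TypT Γ (.var k) A
  | app {Γ : List Ty} {t u : Tm} {A B : Ty} :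
      TypT Γ t (.arrow B A) → TypT Γ u B → TypT Γ (.app t u) A
  | lam {Γ : List Ty} {t : Tm} {A B : Ty} :
      TypT (B :: Γ) t A → TypT Γ (.lam t) (.arrow B A)
  | sub {Γ Γ' : List Ty} {t : Tm} {s : Sb} {A : Ty} :
      TypS Γ s Γ' → TypT Γ' t A → TypT Γ (.sub t s) A

/-- Typing of substitutions: `TypS Γ s Γ'` is `Γ ⊢ s ▷ Γ'`. -/
inductive TypS : List Ty → Sb → List Ty → Prop
  | slash {Γ : List Ty} {t : Tm} {A : Ty} :
      TypT Γ t A → TypS Γ (.slash t) (A :: Γ)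
  | shift {Γ : List Ty} {A : Ty} : TypS (A :: Γ) .shift Γ
  | lift {Γ Γ' : List Ty} {s : Sb} {A B : Ty} :
      TypS Γ s (B :: Γ') → TypS (A :: Γ) (.lift s) (A :: B :: Γ')
end

mutual
/-- The expansion `Ateb` from λυ-terms to substitution-free terms. -/
def Ateb : Tm → Tm
  | .var k => .var k
  | .app t u => .app (Ateb t) (Ateb u)
  | .lam t => .lam (Ateb t)
  | .sub t s => AtebS 0 (Ateb t) s

/-- Auxiliary function: `AtebS i a s` computes the expansion of `a[⇑ⁱ(s)]`
for `a` an already expanded term. -/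
def AtebS : ℕ → Tm → Sb → Tm
  | i, a, .slash u => .app (.lam (liftcons i a)) (shiftN i (Ateb u))
  | i, a, .shift => liftshift i a
  | i, a, .lift s => AtebS (i + 1) a s
end

mutual
/-- The flattening function `ol`. -/
def ol : Tm → Tm
  | .var k => .var k
  | .app t u => .app (ol t) (ol u)
  | .lam t => .lam (ol t)
  | .sub t s => olS 0 (ol t) s

/-- Auxiliary function: `olS i a s` computes the flattening of `a[⇑ⁱ(s)]`
for `a` an already flattened term. -/
def olS : ℕ → Tm → Sb → Tm
  | i, a, .slash u => .sub (liftcons i a) (.slash (shiftN i (ol u)))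
  | i, a, .shift => liftshift i a
  | i, a, .lift s => olS (i + 1) a s
end

mutual
/-- The rule `B` of λυ, closed under arbitrary contexts. -/
inductive StepB : Tm → Tm → Prop
  | beta {t u : Tm} : StepB (.app (.lam t) u) (.sub t (.slash u))
  | appl {t t' u : Tm} : StepB t t' → StepB (.app t u) (.app t' u)
  | appr {t u u' : Tm} : StepB u u' → StepB (.app t u) (.app t u')
  | lam {t t' : Tm} : StepB t t' → StepB (.lam t) (.lam t')
  | subt {t t' : Tm} {s : Sb} : StepB t t' → StepB (.sub t s) (.sub t' s)
  | subs {t : Tm} {s s' : Sb} : StepBS s s' → StepB (.sub t s) (.sub t s')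

/-- The rule `B` inside substitutions. -/
inductive StepBS : Sb → Sb → Prop
  | slash {t t' : Tm} : StepB t t' → StepBS (.slash t) (.slash t')
  | lift {s s' : Sb} : StepBS s s' → StepBS (.lift s) (.lift s')
end

mutual
/-- The rules of λυ other than `B` (App, Lambda, FVar, RVar, FVarLift,
RVarLift, VarShift), closed under arbitrary contexts. -/
inductive StepO : Tm → Tm → Prop
  | app_s {t u : Tm} {s : Sb} :
      StepO (.sub (.app t u) s) (.app (.sub t s) (.sub u s))
  | lam_s {t : Tm} {s : Sb} : StepO (.sub (.lam t) s) (.lam (.sub t (.lift s)))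
  | fvar {t : Tm} : StepO (.sub (.var 0) (.slash t)) t
  | rvar {t : Tm} {k : ℕ} : StepO (.sub (.var (k + 1)) (.slash t)) (.var k)
  | fvarlift {s : Sb} : StepO (.sub (.var 0) (.lift s)) (.var 0)
  | rvarlift {s : Sb} {k : ℕ} :
      StepO (.sub (.var (k + 1)) (.lift s)) (.sub (.sub (.var k) s) .shift)
  | varshift {k : ℕ} : StepO (.sub (.var k) .shift) (.var (k + 1))
  | appl {t t' u : Tm} : StepO t t' → StepO (.app t u) (.app t' u)
  | appr {t u u' : Tm} : StepO u u' → StepO (.app t u) (.app t u')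
  | lam {t t' : Tm} : StepO t t' → StepO (.lam t) (.lam t')
  | subt {t t' : Tm} {s : Sb} : StepO t t' → StepO (.sub t s) (.sub t' s)
  | subs {t : Tm} {s s' : Sb} : StepOS s s' → StepO (.sub t s) (.sub t s')

/-- The rules other than `B` inside substitutions. -/
inductive StepOS : Sb → Sb → Prop
  | slash {t t' : Tm} : StepO t t' → StepOS (.slash t) (.slash t')
  | lift {s s' : Sb} : StepOS s s' → StepOS (.lift s) (.lift s')
end

/-- The full λυ-reduction: the union of `B` and the other rules. -/
def Step (t u : Tm) : Prop := StepB t u ∨ StepO t u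

mutual
/-- The skeleton order `≼` on terms. -/
inductive PrecT : Tm → Tm → Prop
  | var (n m : ℕ) : PrecT (.var n) (.var m)
  | app {t t' u u' : Tm} : PrecT t t' → PrecT u u' → PrecT (.app t u) (.app t' u')
  | lam {t t' : Tm} : PrecT t t' → PrecT (.lam t) (.lam t')
  | shift_r {t t' : Tm} : PrecT t t' → PrecT t (.sub t' .shift)
  | sub {t t' : Tm} {s s' : Sb} :
      PrecT t t' → PrecS s s' → PrecT (.sub t s) (.sub t' s')

/-- The skeleton order `≼` on substitutions. -/
inductive PrecS : Sb → Sb → Prop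
  | shift : PrecS .shift .shift
  | slash {t t' : Tm} : PrecT t t' → PrecS (.slash t) (.slash t')
  | lift {s s' : Sb} : PrecS s s' → PrecS (.lift s) (.lift s')
  | lift_r {s s' : Sb} : PrecS s s' → PrecS s (.lift s')
end

/-- The relation `⋖` : `u ⋖ t` iff `ol u = ol t` and `u ≼ t`. -/
def Lessdot (u t : Tm) : Prop := ol u = ol t ∧ PrecT u t

/-- Meta-level de Bruijn substitution, used for β-reduction on pure terms:
`bsub k u t` substitutes `u` for the index `k+1` in `t`. -/
def bsub (k : ℕ) (u : Tm) : Tm → Tm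
  | .var n => if n = k then shiftN k u else if k < n then .var (n - 1) else .var n
  | .app t v => .app (bsub k u t) (bsub k u v)
  | .lam t => .lam (bsub (k + 1) u t)
  | .sub t s => .sub (bsub k u t) s

/-- β-reduction on pure (substitution-free) de Bruijn terms. -/
inductive BetaP : Tm → Tm → Prop
  | beta {t u : Tm} : BetaP (.app (.lam t) u) (bsub 0 u t)
  | appl {t t' u : Tm} : BetaP t t' → BetaP (.app t u) (.app t' u)
  | appr {t u u' : Tm} : BetaP u u' → BetaP (.app t u) (.app t u')
  | lam {t t' : Tm} : BetaP t t' → BetaP (.lam t) (.lam t')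

/-- Strong normalization. -/
def SN (r : Tm → Tm → Prop) (t : Tm) : Prop := Acc (fun a b => r b a) t


/-- Re-indexing by a family `F`, where `F d` acts on the indices occurring under `d` binders. -/
def ren (F : ℕ → ℕ → ℕ) : Tm → Tm
  | .var k => .var (F 0 k)
  | .app t u => .app (ren F t) (ren F u)
  | .lam t => .lam (ren (fun d => F (d + 1)) t)
  | .sub t (.slash u) => .sub (ren (fun d => F (d + 1)) t) (.slash (ren F u))
  | .sub t s => .sub t s

theorem ren_ren (F G : ℕ → ℕ → ℕ) (t : Tm) :
    ren F (ren G t) = ren (fun d k => F d (G d k)) t := by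
  fun_induction ren G t generalizing F <;> simp_all [ren]

theorem ren_id (t : Tm) : ren (fun _ k => k) t = t := by
  generalize hF : (fun _ k => k : ℕ → ℕ → ℕ) = F
  fun_induction ren F t <;> subst hF <;> simp_all

theorem liftshift_eq_ren (i : ℕ) (t : Tm) :
    liftshift i t = ren (fun d k => if i + d ≤ k then k + 1 else k) t := by
  fun_induction liftshift i t <;>
    simp_all [ren, Nat.add_comm, Nat.add_left_comm]

theorem liftcons_eq_ren (i : ℕ) (t : Tm) :
    liftcons i t =
      ren (fun d k => if i + d < k then k else if k = i + d then 0 else k + 1) t := by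
  fun_induction liftcons i t <;>
    simp_all [ren, Nat.add_comm, Nat.add_left_comm]

theorem shiftN_eq_ren (i : ℕ) (t : Tm) :
    shiftN i t = ren (fun d k => if d ≤ k then k + i else k) t := by
  induction i with
  | zero => simp [shiftN, ren_id]
  | succ i ih =>
    rw [shiftN, Function.iterate_succ_apply', ← shiftN, ih, liftshift_eq_ren, ren_ren]
    congr 1
    funext d k
    split_ifs <;> omega

theorem ren_eq_ren_of_imp {F G F' G' : ℕ → ℕ → ℕ} {a b : Tm} (h : ren F a = ren G b)
    (hFG : ∀ d k l, F d k = G d l → F' d k = G' d l) : ren F' a = ren G' b := by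
  fun_induction ren F a generalizing G F' G' b with
  | case1 F k =>
    rcases b with l | _ | _ | ⟨_, _ | _ | _⟩ <;> simp only [ren, reduceCtorEq] at h
    simpa [ren] using hFG 0 k l (by simpa using h)
  | case2 F t u iht ihu =>
    rcases b with _ | ⟨t', u'⟩ | _ | ⟨_, _ | _ | _⟩ <;> simp [ren] at h ⊢
    exact ⟨iht h.1 hFG, ihu h.2 hFG⟩
  | case3 F t ih =>
    rcases b with _ | _ | t' | ⟨_, _ | _ | _⟩ <;> simp [ren] at h ⊢
    exact ih h fun d => hFG (d + 1)
  | case4 F t u iht ihu =>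
    rcases b with _ | _ | _ | ⟨t', u' | _ | _⟩ <;> simp [ren] at h ⊢
    exact ⟨iht h.1 fun d => hFG (d + 1), ihu h.2 hFG⟩
  | case5 F t s hs =>
    rcases s with _ | _ | _
    · exact (hs _ rfl).elim
    all_goals rcases b with _ | _ | _ | ⟨t', _ | _ | _⟩ <;> simp_all [ren]

/-- Two families are compatible when they identify a bound index with itself and with nothing
else. -/
def Compat (F G : ℕ → ℕ → ℕ) : Prop :=
  ∀ d k l, k < d ∨ l < d → (F d k = G d l ↔ k = l)

theorem Compat.tail {F G : ℕ → ℕ → ℕ} (h : Compat F G) :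
    Compat (fun d => F (d + 1)) (fun d => G (d + 1)) :=
  fun d k l hd => h (d + 1) k l (by omega)

theorem Compat.comp {F G F' G' : ℕ → ℕ → ℕ} (h : Compat F G) (h' : Compat F' G')
    (hF : ∀ d k, k < d → F' d k < d) (hG : ∀ d k, k < d → G' d k < d) :
    Compat (fun d k => F d (F' d k)) (fun d k => G d (G' d k)) :=
  fun d k l hd => (h d _ _ (hd.imp (hF d k) (hG d l))).trans (h' d k l hd)

theorem Compat.comp_liftshift {F G : ℕ → ℕ → ℕ} (h : Compat F G) (i j : ℕ) :
    Compat (fun d k => F d (if i + d ≤ k then k + 1 else k))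
      (fun d k => G d (if j + d ≤ k then k + 1 else k)) := by
  refine h.comp ?_ ?_ ?_
  · intro d k l hd
    dsimp only
    split_ifs <;> omega
  all_goals intro d k hk; split_ifs <;> omega

theorem Compat.comp_liftshift_right {F G : ℕ → ℕ → ℕ} (h : Compat F G) (i : ℕ) :
    Compat F (fun d k => G d (if i + d ≤ k then k + 1 else k)) := by
  refine h.comp (F' := fun _ k => k) ?_ (fun _ _ => id) ?_
  · intro d k l hd
    dsimp only
    split_ifs <;> omega
  · intro d k hk
    split_ifs <;> omega

theorem Compat.comp_shiftN {F G : ℕ → ℕ → ℕ} (h : Compat F G) (i j : ℕ) :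
    Compat (fun d k => F d (if d ≤ k then k + i else k))
      (fun d k => G d (if d ≤ k then k + j else k)) := by
  refine h.comp ?_ ?_ ?_
  · intro d k l hd
    dsimp only
    split_ifs <;> omega
  all_goals intro d k hk; split_ifs <;> omega

theorem Compat.comp_liftcons {F G : ℕ → ℕ → ℕ} (h : Compat F G) (i j : ℕ) :
    Compat
      (fun d k => F (d + 1) (if i + d < k then k else if k = i + d then 0 else k + 1))
      (fun d k => G (d + 1) (if j + d < k then k else if k = j + d then 0 else k + 1)) := by
  intro d k l hd
  dsimp only
  rw [h (d + 1) _ _ (by split_ifs <;> omega)]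
  split_ifs <;> grind

/-- Equality of two flattened closures, up to compatible re-indexings, splits into a condition on
the bodies and a condition `K` on the substitutions. -/
theorem exists_compat_olS {s s' : Sb} (hs : PrecS s s') {F G : ℕ → ℕ → ℕ} (h : Compat F G)
    (i j : ℕ) : ∃ F' G', ∃ K : Prop, Compat F' G' ∧ ∀ a b,
      ren F (olS i a s) = ren G (olS j b s') ↔ ren F' a = ren G' b ∧ K := by
  match hs with
  | .shift =>
    refine ⟨_, _, True, h.comp_liftshift i j, fun a b => ?_⟩
    simp [olS, liftshift_eq_ren, ren_ren]
  | .slash (t := t) (t' := t') _ =>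
    refine ⟨_, _, ren F (shiftN i (ol t)) = ren G (shiftN j (ol t')),
      h.comp_liftcons i j, fun a b => ?_⟩
    simp [olS, ren, liftcons_eq_ren, ren_ren]
  | .lift hs =>
    simpa only [olS] using exists_compat_olS hs h (i + 1) (j + 1)
  | .lift_r hs =>
    simpa only [olS] using exists_compat_olS hs h i (j + 1)

mutual

theorem StepB.simulation {t t' : Tm} (ht : StepB t t') {u : Tm} (hu : PrecT u t)
    {F G : ℕ → ℕ → ℕ} (h : Compat F G) (e : ren F (ol u) = ren G (ol t)) :
    ∃ u', StepB u u' ∧ PrecT u' t' ∧ ren F (ol u') = ren G (ol t') := by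
  match ht, hu with
  | .beta, .app (.lam h₁) h₂ =>
    refine ⟨_, .beta, .sub h₁ (.slash h₂), ?_⟩
    simp only [ol, ren, Tm.app.injEq, Tm.lam.injEq] at e
    simp only [ol, olS, ren, shiftN, Function.iterate_zero, id, e.2, liftcons_eq_ren, ren_ren,
      Tm.sub.injEq, and_true]
    refine ren_eq_ren_of_imp e.1 fun d k l hkl => ?_
    by_cases hd : k < d + 1 ∨ l < d + 1
    · obtain rfl := (h (d + 1) k l hd).1 hkl
      exact (h (d + 1) _ _ (by split_ifs <;> omega)).2 rfl
    · rw [if_pos (by omega), if_pos (by omega)]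
      exact hkl
  | .appl hs, .app h₁ h₂ =>
    simp only [ol, ren, Tm.app.injEq] at e
    obtain ⟨u', hu', hp, e'⟩ := hs.simulation h₁ h e.1
    exact ⟨_, .appl hu', .app hp h₂, by simp [ol, ren, e', e.2]⟩
  | .appr hs, .app h₁ h₂ =>
    simp only [ol, ren, Tm.app.injEq] at e
    obtain ⟨u', hu', hp, e'⟩ := hs.simulation h₂ h e.2
    exact ⟨_, .appr hu', .app h₁ hp, by simp [ol, ren, e', e.1]⟩
  | .lam hs, .lam h₁ =>
    simp only [ol, ren, Tm.lam.injEq] at e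
    obtain ⟨u', hu', hp, e'⟩ := hs.simulation h₁ h.tail e
    exact ⟨_, .lam hu', .lam hp, by simp [ol, ren, e']⟩
  | .subt hs, .shift_r h₁ =>
    simp only [ol, olS, liftshift_eq_ren, ren_ren] at e ⊢
    obtain ⟨u', hu', hp, e'⟩ := hs.simulation h₁ (h.comp_liftshift_right 0) e
    exact ⟨u', hu', .shift_r hp, e'⟩
  | .subt hs, .sub h₁ h₂ =>
    obtain ⟨F', G', K, hc, hK⟩ := exists_compat_olS h₂ h 0 0
    simp only [ol, hK] at e
    obtain ⟨u', hu', hp, e'⟩ := hs.simulation h₁ hc e.1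
    exact ⟨_, .subt hu', .sub hp h₂, by simp only [ol, hK]; exact ⟨e', e.2⟩⟩
  | .subs hs, .sub h₁ h₂ =>
    obtain ⟨s', hs', hp, e'⟩ := hs.simulation h₂ h e
    exact ⟨_, .subs hs', .sub h₁ hp, e'⟩

theorem StepBS.simulation {s s' : Sb} (hs : StepBS s s') {r : Sb} (hr : PrecS r s)
    {F G : ℕ → ℕ → ℕ} (h : Compat F G) {i j : ℕ} {a b : Tm}
    (e : ren F (olS i a r) = ren G (olS j b s)) :
    ∃ r', StepBS r r' ∧ PrecS r' s' ∧ ren F (olS i a r') = ren G (olS j b s') := by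
  match hs, hr with
  | .slash ht, .slash h₁ =>
    simp only [olS, ren, shiftN_eq_ren, ren_ren, Tm.sub.injEq, Sb.slash.injEq] at e
    obtain ⟨u', hu', hp, e'⟩ := ht.simulation h₁ (h.comp_shiftN i j) e.2
    exact ⟨_, .slash hu', .slash hp, by simp [olS, ren, shiftN_eq_ren, ren_ren, e', e.1]⟩
  | .lift hs, .lift h₁ =>
    obtain ⟨r', hr', hp, e'⟩ := hs.simulation h₁ h (i := i + 1) (j := j + 1) e
    exact ⟨_, .lift hr', .lift hp, e'⟩
  | .lift hs, .lift_r h₁ =>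
    obtain ⟨r', hr', hp, e'⟩ := hs.simulation h₁ h (j := j + 1) e
    exact ⟨_, hr', .lift_r hp, e'⟩

end

/-- Simulation of the rule `B`: if `t →_B t'` then for every `u ⋖ t` there
exists `u'` with `u →_B u'` and `u' ⋖ t'`. -/
theorem simulation_B (t t' : Tm) (h : StepB t t') :
    ∀ u : Tm, Lessdot u t → ∃ u' : Tm, StepB u u' ∧ Lessdot u' t' := by
  rintro u ⟨e, hu⟩
  obtain ⟨u', hu', hp, e'⟩ :=
    h.simulation hu (F := fun _ k => k) (G := fun _ k => k) (fun _ _ _ _ => Iff.rfl) (by rw [e])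
  exact ⟨u', hu', by simpa only [ren_id] using e', hp⟩

end LambdaUpsilon
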